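/- Let A ∈ ℝ^{M×N} with N = 2m+1 odd, y ∈ ℝ^M, μ > 0 and γ > 1, and let x* ∈ ℝ^N be a fixed point of the adaptive ISTA iteration with MAD thresholding, i.e. x* = soft(z*, γ·med(|z*|)) with z* = x* − μAᵀ(Ax* − y). Then med(|z*|) = μ·med(|Aᵀ(Ax* − y)|). -/

import Mathlib

open Matrix

noncomputable def soft {N : ℕ} (z : Fin N → ℝ) (τ : ℝ) : Fin N → ℝ :=
  fun i => Real.sign (z i) * max (|z i| - τ) 0

/-- The median of a vector of odd length `2*m+1`: its `(m+1)`-th smallest entry. -/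
noncomputable def med {m : ℕ} (v : Fin (2 * m + 1) → ℝ) : ℝ :=
  ((Finset.univ.val.map v).sort (· ≤ ·)).getD m 0

theorem length_sort_map_univ {n : ℕ} (v : Fin n → ℝ) :
    ((Finset.univ.val.map v).sort (· ≤ ·)).length = n := by
  simp

/-- The median is one of the entries. -/
theorem exists_med_eq {m : ℕ} (v : Fin (2 * m + 1) → ℝ) : ∃ i, med v = v i := by
  have hlen := length_sort_map_univ v
  have hmem : med v ∈ (Finset.univ.val.map v).sort (· ≤ ·) := by
    rw [med, List.getD_eq_getElem _ _ (by omega)]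
    exact List.getElem_mem _
  obtain ⟨i, -, hi⟩ := Multiset.mem_map.1 ((Multiset.mem_sort _).1 hmem)
  exact ⟨i, hi.symm⟩

/-- The median commutes with monotone maps. -/
theorem med_comp_monotone {m : ℕ} {f : ℝ → ℝ} (hf : Monotone f) (v : Fin (2 * m + 1) → ℝ) :
    med (fun i => f (v i)) = f (med v) := by
  have hsort : (Finset.univ.val.map fun i => f (v i)).sort (· ≤ ·) =
      ((Finset.univ.val.map v).sort (· ≤ ·)).map f := by
    refine List.Perm.eq_of_pairwise' (Multiset.pairwise_sort _ _)
      ((Multiset.pairwise_sort _ _).map f fun _ _ h => hf h) ?_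
    rw [← Multiset.coe_eq_coe, ← Multiset.map_coe, Multiset.sort_eq, Multiset.sort_eq,
      Multiset.map_map]
    rfl
  have hlen := length_sort_map_univ v
  rw [med, med, hsort, List.getD_eq_getElem _ _ (by rw [List.length_map]; omega),
    List.getD_eq_getElem _ _ (by omega), List.getElem_map]

/-- The residual of soft thresholding is the clipped magnitude. -/
theorem abs_soft_sub {N : ℕ} (z : Fin N → ℝ) {τ : ℝ} (hτ : 0 ≤ τ) (i : Fin N) :
    |soft z τ i - z i| = min |z i| τ := by
  rw [soft]
  rcases le_total |z i| τ with h | h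
  · rw [max_eq_right (sub_nonpos.2 h), min_eq_left h, mul_zero, zero_sub, abs_neg]
  · rw [max_eq_left (sub_nonneg.2 h), min_eq_right h]
    rcases lt_trichotomy (z i) 0 with hz | hz | hz
    · rw [Real.sign_of_neg hz, abs_of_neg hz, show -1 * (-z i - τ) - z i = τ by ring,
        abs_of_nonneg hτ]
    · rw [hz, abs_zero] at h
      rw [hz, Real.sign_zero, zero_mul, sub_zero, abs_zero]
      exact le_antisymm hτ h
    · rw [Real.sign_of_pos hz, abs_of_pos hz, show 1 * (z i - τ) - z i = -τ by ring,
        abs_neg, abs_of_nonneg hτ]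

theorem stmt_7 {M m : ℕ} (A : Matrix (Fin M) (Fin (2 * m + 1)) ℝ)
    (y : Fin M → ℝ) (μ γ : ℝ) (hμ : 0 < μ) (hγ : 1 < γ)
    (x g z : Fin (2 * m + 1) → ℝ)
    (hg : g = Aᵀ *ᵥ (A *ᵥ x - y))
    (hz : z = x - μ • g)
    (hfix : x = soft z (γ * med (fun i => |z i|))) :
    med (fun i => |z i|) = μ * med (fun i => |g i|) := by
  have hmed : 0 ≤ med fun i => |z i| := by
    obtain ⟨i, hi⟩ := exists_med_eq fun i => |z i|
    exact hi ▸ abs_nonneg _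
  have hle : (med fun i => |z i|) ≤ γ * med fun i => |z i| := le_mul_of_one_le_left hmed hγ.le
  have hclip (i) : μ * |g i| = min |z i| (γ * med fun i => |z i|) := by
    rw [← abs_soft_sub z (hmed.trans hle) i, ← hfix, ← abs_of_pos hμ, ← abs_mul]
    simp [hz]
  have hmono : Monotone fun s => min s (γ * med fun i => |z i|) :=
    fun _ _ h => min_le_min_right _ h
  rw [← med_comp_monotone (f := fun s => μ * s) (fun _ _ h => mul_le_mul_of_nonneg_left h hμ.le)]
  simp only [hclip]
  rw [med_comp_monotone hmono, min_eq_left hle]
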